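/- Let p ∈ 𝒦 with coordinates (Σ₁,Σ₂,Σ₃,0,0,0). The total (Fréchet) derivative DX(p) of the Wainwright–Hsu vector field at p satisfies: DX(p)·e_{Nᵢ} = −(2+2Σᵢ)·e_{Nᵢ} for each i ∈ {1,2,3} (where e_{Nᵢ} is the standard basis vector of the Nᵢ-coordinate), and DX(p)·v = 0 for the vector v = (Σ₂−Σ₃, Σ₃−Σ₁, Σ₁−Σ₂, 0, 0, 0), which is tangent to the Kasner circle at p. Thus DX(p) has eigenvalues −(2+2Σ₁), −(2+2Σ₂), −(2+2Σ₃) and 0, the zero eigenvalue corresponding to the direction of the Kasner circle. -/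

import Mathlib

noncomputable section

/-- `q = (Σ₁²+Σ₂²+Σ₃²)/3`. Coordinates: `p 0,p 1,p 2 = Σ₁,Σ₂,Σ₃`, `p 3,p 4,p 5 = N₁,N₂,N₃`. -/
def WHq (p : Fin 6 → ℝ) : ℝ := (p 0 ^ 2 + p 1 ^ 2 + p 2 ^ 2) / 3

/-- The Wainwright–Hsu vector field on ℝ⁶. -/
def WHX (p : Fin 6 → ℝ) : Fin 6 → ℝ :=
  ![(2 - WHq p) * p 0
      - (2 * p 3 ^ 2 - p 4 ^ 2 - p 5 ^ 2 + 2 * p 4 * p 5 - p 3 * p 4 - p 3 * p 5) / 3,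
    (2 - WHq p) * p 1
      - (2 * p 4 ^ 2 - p 5 ^ 2 - p 3 ^ 2 + 2 * p 5 * p 3 - p 4 * p 5 - p 4 * p 3) / 3,
    (2 - WHq p) * p 2
      - (2 * p 5 ^ 2 - p 3 ^ 2 - p 4 ^ 2 + 2 * p 3 * p 4 - p 5 * p 3 - p 5 * p 4) / 3,
    -(WHq p + 2 * p 0) * p 3,
    -(WHq p + 2 * p 1) * p 4,
    -(WHq p + 2 * p 2) * p 5]

/-- `Ω = 6 − (Σ₁²+Σ₂²+Σ₃²) + (1/2)(N₁²+N₂²+N₃²) − (N₁N₂+N₁N₃+N₂N₃)`. -/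
def WHOmega (p : Fin 6 → ℝ) : ℝ :=
  6 - (p 0 ^ 2 + p 1 ^ 2 + p 2 ^ 2) + (1 / 2) * (p 3 ^ 2 + p 4 ^ 2 + p 5 ^ 2)
    - (p 3 * p 4 + p 3 * p 5 + p 4 * p 5)

/-- The phase space ℬ. -/
def WHB : Set (Fin 6 → ℝ) := {p | p 0 + p 1 + p 2 = 0 ∧ WHOmega p = 0}


/-- The Kasner circle 𝒦. -/
def KasnerCircle : Set (Fin 6 → ℝ) :=
  {p | p 0 + p 1 + p 2 = 0 ∧ p 0 ^ 2 + p 1 ^ 2 + p 2 ^ 2 = 6 ∧ p 3 = 0 ∧ p 4 = 0 ∧ p 5 = 0}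

theorem hasDerivAt_line_apply {ι : Type*} (p v : ι → ℝ) (i : ι) :
    HasDerivAt (fun t : ℝ => (p + t • v) i) (v i) 0 := by
  simpa using ((hasDerivAt_id (0 : ℝ)).mul_const (v i)).const_add (p i)

theorem hasDerivAt_WHq_line (p v : Fin 6 → ℝ) :
    HasDerivAt (fun t : ℝ => WHq (p + t • v)) (2 / 3 * (p 0 * v 0 + p 1 * v 1 + p 2 * v 2)) 0 := by
  have h := hasDerivAt_line_apply p v
  refine (((((h 0).pow 2).add ((h 1).pow 2)).add ((h 2).pow 2)).div_const 3).congr_deriv ?_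
  simp only [zero_smul, add_zero]
  ring

theorem hasDerivAt_shear_line {p v : Fin 6 → ℝ} (hq : WHq p = 2) (i j k l : Fin 6)
    (hj : p j = 0) (hk : p k = 0) (hl : p l = 0) :
    HasDerivAt (fun t : ℝ => (2 - WHq (p + t • v)) * (p + t • v) i
      - (2 * (p + t • v) j ^ 2 - (p + t • v) k ^ 2 - (p + t • v) l ^ 2
        + 2 * (p + t • v) k * (p + t • v) l - (p + t • v) j * (p + t • v) k
        - (p + t • v) j * (p + t • v) l) / 3)
      (-(2 / 3) * (p 0 * v 0 + p 1 * v 1 + p 2 * v 2) * p i) 0 := by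
  have h := hasDerivAt_line_apply p v
  refine ((((hasDerivAt_WHq_line p v).const_sub 2).mul (h i)).sub
    (((((((((h j).pow 2).const_mul 2).sub ((h k).pow 2)).sub ((h l).pow 2)).add
      (((h k).const_mul 2).mul (h l))).sub ((h j).mul (h k))).sub
        ((h j).mul (h l))).div_const 3)).congr_deriv ?_
  simp only [zero_smul, add_zero, hq, hj, hk, hl]
  ring

theorem hasDerivAt_curvature_line {p v : Fin 6 → ℝ} (hq : WHq p = 2) (i j : Fin 6)
    (hj : p j = 0) :
    HasDerivAt (fun t : ℝ => -(WHq (p + t • v) + 2 * (p + t • v) i) * (p + t • v) j)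
      (-(2 + 2 * p i) * v j) 0 := by
  have h := hasDerivAt_line_apply p v
  refine ((((hasDerivAt_WHq_line p v).add ((h i).const_mul 2)).neg).mul (h j)).congr_deriv ?_
  simp [hq, hj]

/-- The directional derivatives of the Wainwright–Hsu vector field on the Kasner circle. -/
theorem hasLineDerivAt_WHX_of_mem_KasnerCircle {p : Fin 6 → ℝ} (hp : p ∈ KasnerCircle)
    (v : Fin 6 → ℝ) :
    HasLineDerivAt ℝ WHX
      ![-(2 / 3) * (p 0 * v 0 + p 1 * v 1 + p 2 * v 2) * p 0,
        -(2 / 3) * (p 0 * v 0 + p 1 * v 1 + p 2 * v 2) * p 1,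
        -(2 / 3) * (p 0 * v 0 + p 1 * v 1 + p 2 * v 2) * p 2,
        -(2 + 2 * p 0) * v 3, -(2 + 2 * p 1) * v 4, -(2 + 2 * p 2) * v 5] p v := by
  obtain ⟨-, h6, h3, h4, h5⟩ := hp
  have hq : WHq p = 2 := by rw [WHq, h6]; norm_num
  refine hasDerivAt_pi.2 fun i => ?_
  fin_cases i
  · exact hasDerivAt_shear_line hq 0 3 4 5 h3 h4 h5
  · exact hasDerivAt_shear_line hq 1 4 5 3 h4 h5 h3
  · exact hasDerivAt_shear_line hq 2 5 3 4 h5 h3 h4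
  · exact hasDerivAt_curvature_line hq 0 3 h3
  · exact hasDerivAt_curvature_line hq 1 4 h4
  · exact hasDerivAt_curvature_line hq 2 5 h5

/-- At a point `p` of the Kasner circle, the Fréchet derivative of the Wainwright–Hsu
vector field sends each basis vector `e_{Nᵢ}` to `−(2+2Σᵢ)·e_{Nᵢ}`, and kills the vector
`(Σ₂−Σ₃, Σ₃−Σ₁, Σ₁−Σ₂, 0, 0, 0)` tangent to the Kasner circle. -/
theorem WHX_fderiv_on_KasnerCircle (p : Fin 6 → ℝ) (hp : p ∈ KasnerCircle)
    (L : (Fin 6 → ℝ) →L[ℝ] (Fin 6 → ℝ)) (hL : HasFDerivAt WHX L p) :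
    L (Pi.single (3 : Fin 6) (1 : ℝ) : Fin 6 → ℝ) = (-(2 + 2 * p 0)) • (Pi.single (3 : Fin 6) (1 : ℝ) : Fin 6 → ℝ) ∧
    L (Pi.single (4 : Fin 6) (1 : ℝ) : Fin 6 → ℝ) = (-(2 + 2 * p 1)) • (Pi.single (4 : Fin 6) (1 : ℝ) : Fin 6 → ℝ) ∧
    L (Pi.single (5 : Fin 6) (1 : ℝ) : Fin 6 → ℝ) = (-(2 + 2 * p 2)) • (Pi.single (5 : Fin 6) (1 : ℝ) : Fin 6 → ℝ) ∧
    L ![p 1 - p 2, p 2 - p 0, p 0 - p 1, 0, 0, 0] = 0 := by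
  have key (v : Fin 6 → ℝ) :=
    (hL.hasLineDerivAt v).unique (hasLineDerivAt_WHX_of_mem_KasnerCircle hp v)
  refine ⟨?_, ?_, ?_, ?_⟩
  · rw [key]
    ext i
    fin_cases i <;> simp
  · rw [key]
    ext i
    fin_cases i <;> simp
  · rw [key]
    ext i
    fin_cases i <;> simp
  · have hs : p 0 * (p 1 - p 2) + p 1 * (p 2 - p 0) + p 2 * (p 0 - p 1) = 0 := by ring
    rw [key]
    ext i
    fin_cases i <;> simp [hs]
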